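/- (Deterministic core of the Dis² bound.) Let ĥ, h̄, y*, y*_S, y*_T : X → Y be measurable classifiers with λ := ε_{μS}(y*, y*_S) + ε_{μT}(y*, y*_T). If Δ(ĥ, y*) ≤ Δ(ĥ, h̄), then ε_{μT}(ĥ, y*_T) ≤ ε_{μS}(ĥ, y*_S) + Δ(ĥ, h̄) + λ. -/

import Mathlib

open MeasureTheory

/-- Population disagreement between two classifiers under measure `μ`. -/
noncomputable def err {X Y : Type*} [MeasurableSpace X] (μ : Measure X) (h h' : X → Y) : ℝ :=
  (μ {x | h x ≠ h' x}).toReal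

/-- Disagreement discrepancy between target `μT` and source `μS`. -/
noncomputable def disc {X Y : Type*} [MeasurableSpace X] (μS μT : Measure X) (h h' : X → Y) : ℝ :=
  err μT h h' - err μS h h'

theorem err_tri_aux {X Y : Type*} [MeasurableSpace X] (μ : Measure X) [IsProbabilityMeasure μ]
    (a b c : X → Y) : err μ a c ≤ err μ a b + err μ b c := by
  unfold err
  have h : {x | a x ≠ c x} ⊆ {x | a x ≠ b x} ∪ {x | b x ≠ c x} := by
    intro x hx
    by_contra hn
    simp only [Set.mem_union, Set.mem_setOf_eq, not_or, not_not] at hn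
    exact hx (hn.1.trans hn.2)
  exact (measureReal_mono (μ := μ) h).trans (measureReal_union_le _ _)

theorem err_comm_aux {X Y : Type*} [MeasurableSpace X] (μ : Measure X)
    (a b : X → Y) : err μ a b = err μ b a := by
  unfold err
  simp only [ne_comm]

/-- Deterministic core of the Dis² bound: if `Δ(ĥ, y*) ≤ Δ(ĥ, h̄)` then
`ε_{μT}(ĥ, y*_T) ≤ ε_{μS}(ĥ, y*_S) + Δ(ĥ, h̄) + λ`. -/
theorem dis2_deterministic {X Y : Type*} [MeasurableSpace X] [MeasurableSpace Y]
    [MeasurableSingletonClass Y] [Fintype Y] [Nonempty Y] [DecidableEq Y]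
    (μS μT : Measure X) [IsProbabilityMeasure μS] [IsProbabilityMeasure μT]
    (hhat hbar ystar yS yT : X → Y)
    (mhat : Measurable hhat) (mbar : Measurable hbar) (mstar : Measurable ystar)
    (mS : Measurable yS) (mT : Measurable yT)
    (hcritic : disc μS μT hhat ystar ≤ disc μS μT hhat hbar) :
    err μT hhat yT ≤
      err μS hhat yS + disc μS μT hhat hbar + (err μS ystar yS + err μT ystar yT) := by
  have h1 := err_tri_aux μT hhat ystar yT
  have h2 := err_tri_aux μS hhat yS ystar
  have h3 := err_comm_aux μS yS ystar
  unfold disc at *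
  linarith
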